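/- arXiv:1112.5747 — 3 statements merged into one kernel-verified Lean document; each statement's English description precedes it below -/
import Mathlib

section
/- Let X be a Markov chain on [0,∞) with transition kernel K ∈ D(G), let γ be a uniform extremal boundary for K, let m ≥ 1, and let u_t = u(t) be a nonnegative function with u_t → u > 0 as t → ∞. Then the conditional laws of the extremal component, P_{tu_t}[(X_1^{(t)}/t, …, X_m^{(t)}/t) ∈ ·], converge weakly on [0,∞]^m, as t → ∞, to P_u[(T*_1, …, T*_m) ∈ ·]. -/
open MeasureTheory ProbabilityTheory Filter Topology
open scoped NNReal ENNReal

noncomputable section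

/-- `K ∈ D(G)`: the transition kernel `K` is in the domain of attraction of `G`, i.e.
`K(t, t·)` converges weakly to `G` on the compactified half-line `[0,∞]` as `t → ∞`. -/
def KernelDOA (K : Kernel ℝ≥0 ℝ≥0) (G : Measure ℝ≥0) : Prop :=
  ∀ f : C(ℝ≥0∞, ℝ),
    Tendsto (fun t : ℝ≥0 => ∫ x, f ((x / t : ℝ≥0) : ℝ≥0∞) ∂(K t))
      atTop (𝓝 (∫ x, f (x : ℝ≥0∞) ∂G))

/-- A uniform extremal boundary for `K` (relative to `G`): `γ(t) → 0` and
`K(t u_t, t[0,γ(t)]) → G({0})` for every nonnegative `u_t → u > 0`. -/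
def UniformExtremalBoundary (K : Kernel ℝ≥0 ℝ≥0) (G : Measure ℝ≥0)
    (γ : ℝ≥0 → ℝ≥0) : Prop :=
  Tendsto γ atTop (𝓝 0) ∧
    ∀ (u : ℝ≥0) (ut : ℝ≥0 → ℝ≥0), 0 < u → Tendsto ut atTop (𝓝 u) →
      Tendsto (fun t : ℝ≥0 => (K (t * ut t)) (Set.Iic (t * γ t))) atTop (𝓝 (G {0}))

/-- The law of `(X_1, …, X_m)` for the Markov chain with transition kernel `K`
started from `X_0 = y`. -/
def jointLaw (K : Kernel ℝ≥0 ℝ≥0) : (m : ℕ) → ℝ≥0 → Measure (Fin m → ℝ≥0)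
  | 0, _ => Measure.dirac (fun i => i.elim0)
  | m + 1, y => (K y).bind (fun x1 => (jointLaw K m x1).map (Fin.cons x1))

/-- The law of `(T*_1, …, T*_m)` for the tail chain associated with `(G, δ_0)`
started from `T*_0 = u`: `T*_n = u ξ_1 ⋯ ξ_n` with `ξ_i` i.i.d. of law `G`. -/
def tailChainLaw (G : Measure ℝ≥0) [IsProbabilityMeasure G] (m : ℕ) (u : ℝ≥0) :
    Measure (Fin m → ℝ≥0) :=
  (Measure.pi fun _ : Fin m => G).map
    (fun ξ (i : Fin m) => u * ∏ j ∈ Finset.Iic i, ξ j)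

/-- The extremal component at time `i ∈ {1,…,m}` of a trajectory starting at `x0` with
subsequent states `x`, relative to the threshold `c = t·γ(t)`:  `x i` if the chain has
stayed above `c` up to time `i` (so `i < τ(t)`), and `0` otherwise. -/
def ecMap (m : ℕ) (c x0 : ℝ≥0) (x : Fin m → ℝ≥0) (i : Fin m) : ℝ≥0 :=
  haveI := Classical.propDecidable (c < x0 ∧ ∀ j : Fin m, j ≤ i → c < x j)
  if c < x0 ∧ ∀ j : Fin m, j ≤ i → c < x j then x i else 0

/-- Joint convergence along `atTop ×ˢ 𝓝 u` follows from convergence along all functions `ut → u`. -/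
lemma tendsto_atTop_prod_nhds_of_forall {β : Type*} [TopologicalSpace β] {F : ℝ≥0 → ℝ≥0 → β}
    {u : ℝ≥0} {b : β}
    (h : ∀ ut : ℝ≥0 → ℝ≥0, Tendsto ut atTop (𝓝 u) →
      Tendsto (fun t => F t (ut t)) atTop (𝓝 b)) :
    Tendsto (fun p : ℝ≥0 × ℝ≥0 => F p.1 p.2) (atTop ×ˢ 𝓝 u) (𝓝 b) := by
  refine tendsto_of_subseq_tendsto fun ns hns => ?_
  have h1 : Tendsto (fun n => (ns n).1) atTop atTop := tendsto_fst.comp hns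
  have h2 : Tendsto (fun n => (ns n).2) atTop (𝓝 u) := tendsto_snd.comp hns
  obtain ⟨φ, hφ, hmono⟩ := strictMono_subseq_of_tendsto_atTop h1
  refine ⟨φ, ?_⟩
  set t : ℕ → ℝ≥0 := fun n => (ns (φ n)).1 with ht
  have hmono' : StrictMono t := hmono
  let ut : ℝ≥0 → ℝ≥0 := Function.extend t (fun n => (ns (φ n)).2) (fun _ => u)
  have hval : ∀ n, ut (t n) = (ns (φ n)).2 := fun n => hmono'.injective.extend_apply _ _ n
  have hut : Tendsto ut atTop (𝓝 u) := by
    intro V hV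
    obtain ⟨N, hN⟩ := eventually_atTop.1 ((h2.comp hφ.tendsto_atTop).eventually hV)
    refine mem_map.2 (mem_of_superset (Ici_mem_atTop (t N)) fun s hs => ?_)
    by_cases hr : ∃ n, t n = s
    · obtain ⟨n, rfl⟩ := hr
      simp only [Set.mem_preimage, hval]
      exact hN n (hmono'.le_iff_le.1 hs)
    · simp only [Set.mem_preimage, ut, Function.extend_apply' _ _ _ hr]
      exact mem_of_mem_nhds hV
  have := (h ut hut).comp (h1.comp hφ.tendsto_atTop)
  refine this.congr fun n => ?_
  have := hval n
  simp only [Function.comp_apply, ht] at this ⊢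
  rw [this]

lemma integrable_of_abs_le {α : Type*} [MeasurableSpace α] {μ : Measure α} [IsFiniteMeasure μ]
    {g : α → ℝ} (hg : Measurable g) {C : ℝ} (hC : ∀ x, |g x| ≤ C) : Integrable g μ :=
  Integrable.of_bound hg.aestronglyMeasurable C (ae_of_all _ hC)

lemma measurable_comp_coe_ennreal (g : C(ℝ≥0∞, ℝ)) : Measurable fun x : ℝ≥0 => g (x : ℝ≥0∞) :=
  g.continuous.measurable.comp measurable_coe_nnreal_ennreal

lemma integrable_comp_coe_ennreal (g : C(ℝ≥0∞, ℝ)) (μ : Measure ℝ≥0) [IsFiniteMeasure μ] :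
    Integrable (fun x : ℝ≥0 => g (x : ℝ≥0∞)) μ :=
  integrable_of_abs_le (measurable_comp_coe_ennreal g) fun _ => g.norm_coe_le_norm _

/-- Weak convergence on `[0,∞]` integrates locally uniformly converging functions. -/
lemma tendsto_integral_of_tendsto_locally {ι : Type*} {l : Filter ι} {μ : ι → Measure ℝ≥0}
    [∀ i, IsProbabilityMeasure (μ i)] {ν : Measure ℝ≥0}
    (hμ : ∀ g : C(ℝ≥0∞, ℝ), Tendsto (fun i => ∫ x, g (x : ℝ≥0∞) ∂μ i) l
      (𝓝 (∫ x, g (x : ℝ≥0∞) ∂ν)))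
    {Φ : ι → ℝ≥0∞ → ℝ} (hΦm : ∀ i, Measurable (Φ i)) (Ψ : C(ℝ≥0∞, ℝ))
    (hΦ : ∀ x, Tendsto (fun p : ι × ℝ≥0∞ => Φ p.1 p.2) (l ×ˢ 𝓝 x) (𝓝 (Ψ x))) :
    Tendsto (fun i => ∫ x, Φ i (x : ℝ≥0∞) ∂μ i) l (𝓝 (∫ x, Ψ (x : ℝ≥0∞) ∂ν)) := by
  have hunif : TendstoUniformly Φ Ψ l := by
    rw [← tendstoLocallyUniformly_iff_tendstoUniformly_of_compactSpace,
      tendstoLocallyUniformly_iff_forall_tendsto]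
    intro x
    have h := ((Ψ.continuous.tendsto x).comp tendsto_snd).prodMk_nhds (hΦ x)
    exact h.mono_right (nhds_le_uniformity _)
  have hdiff : Tendsto (fun i => ∫ x, Φ i (x : ℝ≥0∞) ∂μ i - ∫ x, Ψ (x : ℝ≥0∞) ∂μ i) l (𝓝 0) := by
    rw [Metric.tendsto_nhds]
    intro ε hε
    filter_upwards [Metric.tendstoUniformly_iff.1 hunif (ε / 2) (half_pos hε)] with i hi
    have hb : ∀ x : ℝ≥0, |Φ i x - Ψ x| ≤ ε / 2 := fun x => by
      have := (hi (x : ℝ≥0∞)).le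
      rwa [dist_comm, Real.dist_eq] at this
    have hd : Integrable (fun x : ℝ≥0 => Φ i x - Ψ x) (μ i) :=
      integrable_of_abs_le (((hΦm i).comp measurable_coe_nnreal_ennreal).sub
        (measurable_comp_coe_ennreal Ψ)) hb
    have hΨ := integrable_comp_coe_ennreal Ψ (μ i)
    have hΦi : Integrable (fun x : ℝ≥0 => Φ i x) (μ i) := by
      simpa [Pi.add_def] using hd.add hΨ
    rw [dist_zero_right, ← integral_sub hΦi hΨ]
    have := norm_integral_le_of_norm_le_const (μ := μ i)
      (f := fun x : ℝ≥0 => Φ i x - Ψ x) (ae_of_all _ hb)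
    simp only [probReal_univ, mul_one] at this
    linarith
  simpa using hdiff.add (hμ Ψ)

/-- A continuous function on `[0,∞]` with values in `[0,1]`, supported in a compact subset of
`(0,∞)`, which increases to the indicator of `(0,∞)` as `n → ∞`. -/
def cutoff (n : ℕ) : C(ℝ≥0∞, ℝ) where
  toFun x := min 1 (max 0 (n * (min x x⁻¹).toReal - 1))
  continuous_toFun := by
    have h : Continuous fun x : ℝ≥0∞ => (min x x⁻¹).toReal := by
      refine continuous_iff_continuousAt.2 fun x => ?_
      refine (ENNReal.continuousAt_toReal ?_).comp (f := fun x : ℝ≥0∞ => min x x⁻¹)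
        (continuous_id.min continuous_inv).continuousAt
      rcases eq_or_ne x ⊤ with rfl | hx
      · simp
      · exact ne_top_of_le_ne_top hx (min_le_left _ _)
    fun_prop

lemma cutoff_nonneg (n : ℕ) (x : ℝ≥0∞) : 0 ≤ cutoff n x :=
  le_min zero_le_one (le_max_left _ _)

lemma cutoff_le_one (n : ℕ) (x : ℝ≥0∞) : cutoff n x ≤ 1 := min_le_left _ _

lemma cutoff_eq_zero {n : ℕ} {x : ℝ≥0∞} (h : n * (min x x⁻¹).toReal ≤ 1) : cutoff n x = 0 := by
  change min 1 (max 0 (n * (min x x⁻¹).toReal - 1)) = 0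
  rw [max_eq_left (by linarith)]
  simp

lemma eventually_cutoff_eq_zero_nhds_zero (n : ℕ) : ∀ᶠ x in 𝓝 (0 : ℝ≥0∞), cutoff n x = 0 := by
  have hpos : (0 : ℝ≥0∞) < (n + 1 : ℝ≥0∞)⁻¹ := by simp
  filter_upwards [Iio_mem_nhds hpos] with x hx
  refine cutoff_eq_zero ?_
  have h1 : (min x x⁻¹).toReal ≤ ((n : ℝ) + 1)⁻¹ := by
    have h2 := ENNReal.toReal_mono (by simp) ((min_le_left x x⁻¹).trans (le_of_lt hx))
    rwa [ENNReal.toReal_inv, ENNReal.toReal_add (by simp) (by simp)] at h2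
  calc n * (min x x⁻¹).toReal ≤ n * ((n : ℝ) + 1)⁻¹ := by gcongr
    _ ≤ 1 := by
      rw [← div_eq_mul_inv, div_le_one (by positivity)]; linarith

lemma eventually_cutoff_eq_zero_nhds_top (n : ℕ) : ∀ᶠ x in 𝓝 (⊤ : ℝ≥0∞), cutoff n x = 0 := by
  have h : Tendsto (fun x : ℝ≥0∞ => x⁻¹) (𝓝 ⊤) (𝓝 0) := by
    simpa using (continuous_inv (G := ℝ≥0∞)).tendsto ⊤
  filter_upwards [h.eventually (eventually_cutoff_eq_zero_nhds_zero n)] with x hx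
  have hsymm : cutoff n x⁻¹ = cutoff n x := by
    change min 1 (max 0 (n * (min x⁻¹ x⁻¹⁻¹).toReal - 1)) = _
    rw [inv_inv, min_comm x⁻¹ x]
    rfl
  rw [← hsymm, hx]

lemma cutoff_zero (n : ℕ) : cutoff n 0 = 0 := (eventually_cutoff_eq_zero_nhds_zero n).self_of_nhds

lemma tendsto_cutoff {x : ℝ≥0} (hx : 0 < x) :
    Tendsto (fun n => cutoff n (x : ℝ≥0∞)) atTop (𝓝 1) := by
  have hw : 0 < (min (x : ℝ≥0∞) (x : ℝ≥0∞)⁻¹).toReal := by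
    refine ENNReal.toReal_pos ?_ (ne_top_of_le_ne_top ENNReal.coe_ne_top (min_le_left _ _))
    simp [min_eq_iff, hx.ne']
  have h : Tendsto (fun n : ℕ => (n : ℝ) * (min (x : ℝ≥0∞) (x : ℝ≥0∞)⁻¹).toReal) atTop atTop :=
    tendsto_natCast_atTop_atTop.atTop_mul_const hw
  refine tendsto_const_nhds.congr' ?_
  filter_upwards [h.eventually_ge_atTop 2] with n hn
  change 1 = min 1 (max 0 (n * (min (x : ℝ≥0∞) (x : ℝ≥0∞)⁻¹).toReal - 1))
  rw [min_eq_left (le_max_of_le_right (by linarith))]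

/-- The product of a continuous function on `[0,∞)` with a cutoff, extended to `[0,∞]`. -/
def mulCutoff (h : ℝ≥0 → ℝ) (hh : Continuous h) (n : ℕ) : C(ℝ≥0∞, ℝ) where
  toFun x := h x.toNNReal * cutoff n x
  continuous_toFun := by
    refine continuous_iff_continuousAt.2 fun x => ?_
    rcases eq_or_ne x ⊤ with rfl | hx
    · refine continuousAt_const (y := (0 : ℝ)) |>.congr ?_
      filter_upwards [eventually_cutoff_eq_zero_nhds_top n] with y hy
      simp [hy]
    · exact (hh.continuousAt.comp (ENNReal.tendsto_toNNReal hx)).mul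
        (cutoff n).continuous.continuousAt

lemma tendsto_integral_one_sub_cutoff (ν : Measure ℝ≥0) [IsProbabilityMeasure ν] :
    Tendsto (fun n => ∫ x, (1 - cutoff n (x : ℝ≥0∞)) ∂ν) atTop (𝓝 (ν.real {0})) := by
  have hlim : ν.real {0} = ∫ x, ({0} : Set ℝ≥0).indicator (fun _ => (1 : ℝ)) x ∂ν := by
    rw [integral_indicator_const _ (measurableSet_singleton _)]; simp
  rw [hlim]
  refine tendsto_integral_of_dominated_convergence (fun _ => 1)
    (fun n => (measurable_const.sub (measurable_comp_coe_ennreal _)).aestronglyMeasurable)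
    (integrable_const _) (fun n => ae_of_all _ fun x => ?_) (ae_of_all _ fun x => ?_)
  · have h0 := cutoff_nonneg n x
    have h1 := cutoff_le_one n x
    rw [Real.norm_eq_abs, abs_le]
    constructor <;> linarith
  · rcases eq_or_ne x 0 with rfl | hx
    · simp [cutoff_zero]
    · simpa [hx] using (tendsto_cutoff (pos_iff_ne_zero.2 hx)).const_sub 1

/-- The error made by cutting off a bounded function that vanishes on `[0, c]`. -/
lemma abs_integral_sub_mul_cutoff_le {μ : Measure ℝ≥0} [IsProbabilityMeasure μ] {H : ℝ≥0 → ℝ}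
    (hH : Measurable H) {M : ℝ} (hM : ∀ v, |H v| ≤ M) {c : ℝ≥0} (hc : ∀ v ≤ c, H v = 0) {n : ℕ}
    (hn : ∀ v ≤ c, cutoff n (v : ℝ≥0∞) = 0) :
    |∫ v, H v ∂μ - ∫ v, H v * cutoff n (v : ℝ≥0∞) ∂μ| ≤
      M * (∫ v, (1 - cutoff n (v : ℝ≥0∞)) ∂μ - μ.real (Set.Iic c)) := by
  have hχ := integrable_comp_coe_ennreal (cutoff n) μ
  have h1χ : Integrable (fun v : ℝ≥0 => 1 - cutoff n (v : ℝ≥0∞)) μ := (integrable_const _).sub hχ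
  have hHi := integrable_of_abs_le (μ := μ) hH hM
  have hHχ : Integrable (fun v : ℝ≥0 => H v * cutoff n (v : ℝ≥0∞)) μ := by
    refine integrable_of_abs_le (hH.mul (measurable_comp_coe_ennreal _)) (C := M) fun v => ?_
    rw [abs_mul, abs_of_nonneg (cutoff_nonneg n v)]
    exact (mul_le_of_le_one_right (abs_nonneg _) (cutoff_le_one n v)).trans (hM v)
  have hind : Integrable ((Set.Iic c).indicator fun _ => (1 : ℝ)) μ :=
    (integrable_const _).indicator measurableSet_Iic
  have hIic : μ.real (Set.Iic c) = ∫ v, (Set.Iic c).indicator (fun _ => (1 : ℝ)) v ∂μ := by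
    rw [integral_indicator_const _ measurableSet_Iic]; simp
  rw [hIic, ← integral_sub hHi hHχ, ← integral_sub h1χ hind,
    ← integral_const_mul, ← Real.norm_eq_abs]
  refine norm_integral_le_of_norm_le ((h1χ.sub hind).const_mul M)
    (ae_of_all _ fun v => ?_)
  by_cases hv : v ≤ c
  · simp [hc v hv, hn v hv, hv]
  · have h0 := cutoff_nonneg n v
    have h1 := cutoff_le_one n v
    simp only [Set.mem_Iic, hv, not_false_eq_true, Set.indicator_of_notMem, sub_zero]
    rw [show H v - H v * cutoff n v = H v * (1 - cutoff n v) by ring, norm_mul, Real.norm_eq_abs,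
      Real.norm_of_nonneg (sub_nonneg.2 h1)]
    exact mul_le_mul_of_nonneg_right (hM v) (sub_nonneg.2 h1)

lemma tendsto_integral_of_boundary_of_zero {ι : Type*} {l : Filter ι} {μ : ι → Measure ℝ≥0}
    [∀ i, IsProbabilityMeasure (μ i)] {ν : Measure ℝ≥0} [IsProbabilityMeasure ν]
    (hμ : ∀ g : C(ℝ≥0∞, ℝ), Tendsto (fun i => ∫ x, g (x : ℝ≥0∞) ∂μ i) l
      (𝓝 (∫ x, g (x : ℝ≥0∞) ∂ν)))
    {c : ι → ℝ≥0} (hc : Tendsto c l (𝓝 0))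
    (hcμ : Tendsto (fun i => (μ i).real (Set.Iic (c i))) l (𝓝 (ν.real {0})))
    {H : ι → ℝ≥0 → ℝ} (hH : ∀ i, Measurable (H i)) {M : ℝ} (hM : ∀ i v, |H i v| ≤ M)
    (hHc : ∀ i, ∀ v ≤ c i, H i v = 0)
    {h : ℝ≥0 → ℝ} (hh : Continuous h) (hhM : ∀ v, |h v| ≤ M) (h0 : h 0 = 0)
    (hlim : ∀ v, 0 < v → Tendsto (fun p : ι × ℝ≥0 => H p.1 p.2) (l ×ˢ 𝓝 v) (𝓝 (h v))) :
    Tendsto (fun i => ∫ v, H i v ∂μ i) l (𝓝 (∫ v, h v ∂ν)) := by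
  have hmid : ∀ n, Tendsto (fun i => ∫ v, H i v * cutoff n (v : ℝ≥0∞) ∂μ i) l
      (𝓝 (∫ v, h v * cutoff n (v : ℝ≥0∞) ∂ν)) := fun n => by
    have key := tendsto_integral_of_tendsto_locally hμ
      (Φ := fun i x => H i x.toNNReal * cutoff n x)
      (fun i => ((hH i).comp ENNReal.measurable_toNNReal).mul (cutoff n).continuous.measurable)
      (mulCutoff h hh n) fun x => ?_
    · simpa [mulCutoff] using key
    have hzero : (∀ᶠ y in 𝓝 x, cutoff n y = 0) →
        Tendsto (fun p : ι × ℝ≥0∞ => H p.1 p.2.toNNReal * cutoff n p.2) (l ×ˢ 𝓝 x)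
          (𝓝 (mulCutoff h hh n x)) := fun hx => by
      have hx0 : mulCutoff h hh n x = 0 := by
        change h x.toNNReal * cutoff n x = 0
        rw [hx.self_of_nhds, mul_zero]
      rw [hx0]
      refine tendsto_const_nhds.congr' ?_
      filter_upwards [tendsto_snd.eventually hx] with p hp
      simp [hp]
    rcases eq_or_ne x ⊤ with rfl | hx
    · exact hzero (eventually_cutoff_eq_zero_nhds_top n)
    rcases eq_or_ne x 0 with rfl | hx0
    · exact hzero (eventually_cutoff_eq_zero_nhds_zero n)
    refine Tendsto.mul ?_ (((cutoff n).continuous.tendsto x).comp tendsto_snd)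
    exact (hlim _ (ENNReal.toNNReal_pos hx0 hx)).comp
      (tendsto_id.prodMap (ENNReal.tendsto_toNNReal hx))
  have hδ : Tendsto (fun n => M * (∫ x, (1 - cutoff n (x : ℝ≥0∞)) ∂ν - ν.real {0})) atTop (𝓝 0) := by
    simpa using ((tendsto_integral_one_sub_cutoff ν).sub_const (ν.real {0})).const_mul M
  rw [Metric.tendsto_nhds]
  intro ε hε
  obtain ⟨n, hn⟩ := (hδ.eventually_lt_const (show 0 < ε / 3 by positivity)).exists
  have hμn : Tendsto
      (fun i => M * (∫ x, (1 - cutoff n (x : ℝ≥0∞)) ∂μ i - (μ i).real (Set.Iic (c i)))) l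
      (𝓝 (M * (∫ x, (1 - cutoff n (x : ℝ≥0∞)) ∂ν - ν.real {0}))) :=
    ((hμ (1 - cutoff n)).sub hcμ).const_mul M
  have hν := abs_integral_sub_mul_cutoff_le (μ := ν) hh.measurable hhM (c := 0) (n := n)
    (fun v hv => by rw [nonpos_iff_eq_zero.1 hv, h0])
    (fun v hv => by rw [nonpos_iff_eq_zero.1 hv]; exact cutoff_zero n)
  have hIic0 : Set.Iic (0 : ℝ≥0) = {0} := by ext; simp
  rw [hIic0] at hν
  obtain ⟨r, hr, hrn⟩ : ∃ r : ℝ≥0, 0 < r ∧ ∀ v < r, cutoff n (v : ℝ≥0∞) = 0 := by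
    have := (ENNReal.continuous_coe.tendsto (0 : ℝ≥0)).eventually
      (eventually_cutoff_eq_zero_nhds_zero n)
    obtain ⟨r, hr, hr'⟩ := (NNReal.nhds_zero_basis).eventually_iff.1 this
    exact ⟨r, hr, fun v hv => hr' hv⟩
  filter_upwards [hμn.eventually_lt_const hn, hc.eventually_lt_const hr,
    Metric.tendsto_nhds.1 (hmid n) (ε / 3) (by positivity)] with i hi hci hmi
  have hi' := abs_integral_sub_mul_cutoff_le (μ := μ i) (hH i) (hM i) (hHc i) (n := n)
    (fun v hv => hrn v (hv.trans_lt hci))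
  rw [Real.dist_eq] at hmi ⊢
  rw [abs_lt] at hmi ⊢
  rw [abs_le] at hi' hν
  constructor <;> linarith

/-- Weak convergence on `[0,∞]`, together with convergence of the mass of `[0, c i]` to the mass of
`{0}`, integrates bounded functions that are constant on `[0, c i]` and converge locally uniformly
on `(0,∞)`. -/
lemma tendsto_integral_of_boundary {ι : Type*} {l : Filter ι} {μ : ι → Measure ℝ≥0}
    [∀ i, IsProbabilityMeasure (μ i)] {ν : Measure ℝ≥0} [IsProbabilityMeasure ν]
    (hμ : ∀ g : C(ℝ≥0∞, ℝ), Tendsto (fun i => ∫ x, g (x : ℝ≥0∞) ∂μ i) l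
      (𝓝 (∫ x, g (x : ℝ≥0∞) ∂ν)))
    {c : ι → ℝ≥0} (hc : Tendsto c l (𝓝 0))
    (hcμ : Tendsto (fun i => (μ i).real (Set.Iic (c i))) l (𝓝 (ν.real {0})))
    {H : ι → ℝ≥0 → ℝ} (hH : ∀ i, Measurable (H i)) {M : ℝ} (hM : ∀ i v, |H i v| ≤ M)
    {h : ℝ≥0 → ℝ} (hh : Continuous h) (hhM : ∀ v, |h v| ≤ M)
    (hHc : ∀ i, ∀ v ≤ c i, H i v = h 0)
    (hlim : ∀ v, 0 < v → Tendsto (fun p : ι × ℝ≥0 => H p.1 p.2) (l ×ˢ 𝓝 v) (𝓝 (h v))) :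
    Tendsto (fun i => ∫ v, H i v ∂μ i) l (𝓝 (∫ v, h v ∂ν)) := by
  have habs : ∀ a : ℝ, |a| ≤ M → |a - h 0| ≤ M + M := fun a ha =>
    (abs_sub _ _).trans (add_le_add ha (hhM 0))
  have key := tendsto_integral_of_boundary_of_zero hμ hc hcμ
    (H := fun i v => H i v - h 0) (fun i => (hH i).sub_const _) (fun i v => habs _ (hM i v))
    (fun i v hv => by rw [hHc i v hv, sub_self]) (h := fun v => h v - h 0)
    (hh.sub continuous_const) (fun v => habs _ (hhM v)) (sub_self _)
    (fun v hv => (hlim v hv).sub_const _)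
  have hi := fun i => integral_sub (integrable_of_abs_le (μ := μ i) (hH i) (hM i))
    (integrable_const (h 0))
  have hi0 := integral_sub (integrable_of_abs_le (μ := ν) hh.measurable hhM)
    (integrable_const (h 0))
  simp only [hi, hi0, integral_const, probReal_univ, one_smul] at key
  simpa using key.add_const (h 0)

/-- The kernel `y ↦ jointLaw K m y`. -/
def jointKernel (K : Kernel ℝ≥0 ℝ≥0) : (m : ℕ) → Kernel ℝ≥0 (Fin m → ℝ≥0)
  | 0 => Kernel.const _ (Measure.dirac fun i => i.elim0)
  | m + 1 => ((Kernel.id ×ₖ jointKernel K m).map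
      fun p : ℝ≥0 × (Fin m → ℝ≥0) => (Fin.cons p.1 p.2 : Fin (m + 1) → ℝ≥0)) ∘ₖ K

lemma measurable_finCons (m : ℕ) :
    Measurable fun p : ℝ≥0 × (Fin m → ℝ≥0) => (Fin.cons p.1 p.2 : Fin (m + 1) → ℝ≥0) :=
  (Continuous.finCons continuous_fst continuous_snd).measurable

instance isMarkovKernel_jointKernel (K : Kernel ℝ≥0 ℝ≥0) [IsMarkovKernel K] (m : ℕ) :
    IsMarkovKernel (jointKernel K m) := by
  induction m with
  | zero => unfold jointKernel; infer_instance
  | succ m ih =>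
    have := Kernel.IsMarkovKernel.map (Kernel.id ×ₖ jointKernel K m) (measurable_finCons m)
    unfold jointKernel
    infer_instance

lemma map_finCons_apply (K : Kernel ℝ≥0 ℝ≥0) [IsMarkovKernel K] (m : ℕ) (y : ℝ≥0) :
    (Kernel.id ×ₖ jointKernel K m).map
      (fun p : ℝ≥0 × (Fin m → ℝ≥0) => (Fin.cons p.1 p.2 : Fin (m + 1) → ℝ≥0)) y =
      (jointKernel K m y).map (Fin.cons y) := by
  rw [Kernel.map_apply _ (measurable_finCons m), Kernel.prod_apply, Kernel.id_apply,
    Measure.dirac_prod, Measure.map_map (measurable_finCons m) measurable_prodMk_left]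
  rfl

lemma jointKernel_apply (K : Kernel ℝ≥0 ℝ≥0) [IsMarkovKernel K] (m : ℕ) (y : ℝ≥0) :
    jointKernel K m y = jointLaw K m y := by
  induction m generalizing y with
  | zero => rfl
  | succ m ih =>
    rw [jointKernel, Kernel.comp_apply, jointLaw]
    congr 1
    ext1 x
    rw [map_finCons_apply, ih]

instance isProbabilityMeasure_jointLaw (K : Kernel ℝ≥0 ℝ≥0) [IsMarkovKernel K] (m : ℕ) (y : ℝ≥0) :
    IsProbabilityMeasure (jointLaw K m y) := by
  rw [← jointKernel_apply]; infer_instance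

lemma integral_jointLaw_succ (K : Kernel ℝ≥0 ℝ≥0) [IsMarkovKernel K] (m : ℕ) (y : ℝ≥0)
    {F : (Fin (m + 1) → ℝ≥0) → ℝ} (hF : Measurable F) {M : ℝ} (hM : ∀ x, |F x| ≤ M) :
    ∫ x, F x ∂jointLaw K (m + 1) y =
      ∫ x₁, ∫ x, F (Fin.cons x₁ x) ∂jointLaw K m x₁ ∂K y := by
  have hint : Integrable F (jointKernel K (m + 1) y) := integrable_of_abs_le hF hM
  rw [← jointKernel_apply]
  rw [jointKernel] at hint ⊢
  rw [Kernel.integral_comp hint]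
  refine integral_congr_ae (ae_of_all _ fun x₁ => ?_)
  simp only
  have hcons : Measurable fun x : Fin m → ℝ≥0 => (Fin.cons x₁ x : Fin (m + 1) → ℝ≥0) :=
    (measurable_finCons m).comp measurable_prodMk_left
  rw [map_finCons_apply, integral_map hcons.aemeasurable hF.aestronglyMeasurable,
    jointKernel_apply]

lemma ecMap_cons_of_lt {m : ℕ} {c x₀ x₁ : ℝ≥0} (h₀ : c < x₀) (h₁ : c < x₁) (x : Fin m → ℝ≥0) :
    ecMap (m + 1) c x₀ (Fin.cons x₁ x) = Fin.cons x₁ (ecMap m c x₁ x) := by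
  ext i
  refine Fin.cases ?_ (fun i => ?_) i
  · simp [ecMap, h₀, h₁]
  · simp [ecMap, h₀, h₁, Fin.forall_fin_succ]

lemma ecMap_cons_of_not_lt {m : ℕ} {c x₀ x₁ : ℝ≥0} (h₁ : ¬ c < x₁) (x : Fin m → ℝ≥0) :
    ecMap (m + 1) c x₀ (Fin.cons x₁ x) = 0 := by
  ext i
  simp [ecMap, h₁, Fin.forall_fin_succ]

lemma measurable_ecMap (m : ℕ) (c : ℝ≥0) :
    Measurable fun p : ℝ≥0 × (Fin m → ℝ≥0) => ecMap m c p.1 p.2 := by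
  refine measurable_pi_lambda _ fun i => ?_
  have hset : MeasurableSet {p : ℝ≥0 × (Fin m → ℝ≥0) | c < p.1 ∧ ∀ j ≤ i, c < p.2 j} := by
    simp only [Set.ofPred_and, Set.ofPred_forall]
    refine (measurableSet_lt measurable_const measurable_fst).inter
      (MeasurableSet.iInter fun j => MeasurableSet.iInter fun _ => ?_)
    exact measurableSet_lt measurable_const ((measurable_pi_apply j).comp measurable_snd)
  exact Measurable.ite hset ((measurable_pi_apply i).comp measurable_snd) measurable_const

/-- The coordinatewise embedding of `[0,∞)^m` scaled by `1 / t` into `[0,∞]^m`. -/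
def scaleCoe (m : ℕ) (t : ℝ≥0) (x : Fin m → ℝ≥0) (i : Fin m) : ℝ≥0∞ := ((x i / t : ℝ≥0) : ℝ≥0∞)

lemma measurable_scaleCoe (m : ℕ) (t : ℝ≥0) : Measurable (scaleCoe m t) := by
  unfold scaleCoe
  fun_prop

lemma scaleCoe_cons {m : ℕ} (t x₁ : ℝ≥0) (x : Fin m → ℝ≥0) :
    scaleCoe (m + 1) t (Fin.cons x₁ x) = Fin.cons ((x₁ / t : ℝ≥0) : ℝ≥0∞) (scaleCoe m t x) := by
  ext i
  refine Fin.cases ?_ (fun i => ?_) i <;> simp [scaleCoe]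

/-- Freezing the first coordinate of a continuous function on `[0,∞]^(m+1)`. -/
def freezeHead {m : ℕ} (f : C((Fin (m + 1) → ℝ≥0∞), ℝ)) : C(ℝ≥0∞, C((Fin m → ℝ≥0∞), ℝ)) :=
  ContinuousMap.curry
    ⟨fun p : ℝ≥0∞ × (Fin m → ℝ≥0∞) => f (Fin.cons p.1 p.2),
      f.continuous.comp (Continuous.finCons continuous_fst continuous_snd)⟩

lemma freezeHead_apply {m : ℕ} (f : C((Fin (m + 1) → ℝ≥0∞), ℝ)) (v : ℝ≥0∞) (x : Fin m → ℝ≥0∞) :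
    freezeHead f v x = f (Fin.cons v x) := rfl

/-- The expectation of `f` under the scaled extremal component started from `t * v`. -/
def ecIntegral (K : Kernel ℝ≥0 ℝ≥0) (γ : ℝ≥0 → ℝ≥0) (m : ℕ) (f : C((Fin m → ℝ≥0∞), ℝ))
    (t v : ℝ≥0) : ℝ :=
  ∫ x, f (scaleCoe m t (ecMap m (t * γ t) (t * v) x)) ∂jointLaw K m (t * v)

/-- The expectation of `f` under the tail chain started from `v`. -/
def tailIntegral (G : Measure ℝ≥0) [IsProbabilityMeasure G] (m : ℕ) (f : C((Fin m → ℝ≥0∞), ℝ))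
    (v : ℝ≥0) : ℝ :=
  ∫ x, f (fun i => (x i : ℝ≥0∞)) ∂tailChainLaw G m v

lemma measurable_scaleCoe_ecMap {m : ℕ} (t c x₀ : ℝ≥0) :
    Measurable fun x : Fin m → ℝ≥0 => scaleCoe m t (ecMap m c x₀ x) :=
  (measurable_scaleCoe m t).comp ((measurable_ecMap m c).comp measurable_prodMk_left)

lemma abs_ecIntegral_sub_le (K : Kernel ℝ≥0 ℝ≥0) [IsMarkovKernel K] (γ : ℝ≥0 → ℝ≥0) (m : ℕ)
    (f g : C((Fin m → ℝ≥0∞), ℝ)) (t v : ℝ≥0) :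
    |ecIntegral K γ m f t v - ecIntegral K γ m g t v| ≤ dist f g := by
  have hi : ∀ f : C((Fin m → ℝ≥0∞), ℝ), Integrable
      (fun x => f (scaleCoe m t (ecMap m (t * γ t) (t * v) x))) (jointLaw K m (t * v)) := fun f =>
    integrable_of_abs_le (f.continuous.measurable.comp (measurable_scaleCoe_ecMap _ _ _))
      fun _ => f.norm_coe_le_norm _
  rw [ecIntegral, ecIntegral, ← integral_sub (hi f) (hi g), ← Real.norm_eq_abs]
  refine (norm_integral_le_of_norm_le_const (C := dist f g) (ae_of_all _ fun x => ?_)).trans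
    (by simp)
  exact ContinuousMap.dist_apply_le_dist (f := f) (g := g) _

lemma abs_ecIntegral_le (K : Kernel ℝ≥0 ℝ≥0) [IsMarkovKernel K] (γ : ℝ≥0 → ℝ≥0) (m : ℕ)
    (f : C((Fin m → ℝ≥0∞), ℝ)) (t v : ℝ≥0) : |ecIntegral K γ m f t v| ≤ ‖f‖ := by
  simpa [ecIntegral] using abs_ecIntegral_sub_le K γ m f 0 t v

lemma norm_freezeHead_le {m : ℕ} (f : C((Fin (m + 1) → ℝ≥0∞), ℝ)) (v : ℝ≥0∞) :
    ‖freezeHead f v‖ ≤ ‖f‖ :=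
  (ContinuousMap.norm_le _ (norm_nonneg f)).2 fun _ => f.norm_coe_le_norm _

lemma measurable_ecIntegral_freezeHead (K : Kernel ℝ≥0 ℝ≥0) [IsMarkovKernel K] (γ : ℝ≥0 → ℝ≥0)
    {m : ℕ} (f : C((Fin (m + 1) → ℝ≥0∞), ℝ)) (t : ℝ≥0) :
    Measurable fun v : ℝ≥0 => ecIntegral K γ m (freezeHead f v) t v := by
  let κ : Kernel ℝ≥0 (Fin m → ℝ≥0) := (jointKernel K m).comap (fun v => t * v)
    (measurable_const_mul t)
  have hcont : Continuous fun p : ℝ≥0∞ × (Fin m → ℝ≥0∞) => freezeHead f p.1 p.2 :=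
    f.continuous.comp (Continuous.finCons continuous_fst continuous_snd)
  have hmeas : Measurable fun p : ℝ≥0 × (Fin m → ℝ≥0) =>
      freezeHead f p.1 (scaleCoe m t (ecMap m (t * γ t) (t * p.1) p.2)) := by
    refine hcont.measurable.comp ((measurable_coe_nnreal_ennreal.comp measurable_fst).prodMk ?_)
    exact (measurable_scaleCoe m t).comp ((measurable_ecMap m _).comp
      ((measurable_fst.const_mul t).prodMk measurable_snd))
  have h := (StronglyMeasurable.integral_kernel_prod_right' (κ := κ)
    hmeas.stronglyMeasurable).measurable
  convert h using 2 with v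
  simp only [ecIntegral, κ, Kernel.comap_apply, jointKernel_apply]

/-- One-step decomposition of the extremal component: after the first step the chain either has
been absorbed at zero or restarts from its new position. -/
lemma ecIntegral_succ (K : Kernel ℝ≥0 ℝ≥0) [IsMarkovKernel K] (γ : ℝ≥0 → ℝ≥0) {m : ℕ}
    (f : C((Fin (m + 1) → ℝ≥0∞), ℝ)) {t v : ℝ≥0} (ht : 0 < t) (hv : γ t < v) :
    ecIntegral K γ (m + 1) f t v =
      ∫ w, (if γ t < w then ecIntegral K γ m (freezeHead f w) t w else f 0)
        ∂(K (t * v)).map (fun x => x / t) := by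
  have hmeas : Measurable fun w : ℝ≥0 =>
      if γ t < w then ecIntegral K γ m (freezeHead f w) t w else f 0 :=
    Measurable.ite measurableSet_Ioi (measurable_ecIntegral_freezeHead K γ f t) measurable_const
  have hF : Measurable fun x : Fin (m + 1) → ℝ≥0 =>
      f (scaleCoe (m + 1) t (ecMap (m + 1) (t * γ t) (t * v) x)) :=
    f.continuous.measurable.comp (measurable_scaleCoe_ecMap _ _ _)
  rw [ecIntegral, integral_map (measurable_div_const t).aemeasurable hmeas.aestronglyMeasurable,
    integral_jointLaw_succ K m _ hF fun _ => f.norm_coe_le_norm _]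
  refine integral_congr_ae (ae_of_all _ fun x₁ => ?_)
  have hc : t * γ t < t * v := mul_lt_mul_of_pos_left hv ht
  have hiff : γ t < x₁ / t ↔ t * γ t < x₁ := by rw [lt_div_iff₀ ht, mul_comm]
  have hx : t * (x₁ / t) = x₁ := mul_div_cancel₀ _ ht.ne'
  by_cases h : t * γ t < x₁
  · simp only [hiff, h, if_true, ecIntegral, hx, freezeHead_apply]
    simp only [ecMap_cons_of_lt hc h, scaleCoe_cons]
  · simp only [hiff, h, if_false, ecMap_cons_of_not_lt h]
    have h0 : scaleCoe (m + 1) t 0 = 0 := by ext; simp [scaleCoe]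
    simp [h0]

lemma tailIntegral_eq (G : Measure ℝ≥0) [IsProbabilityMeasure G] (m : ℕ)
    (f : C((Fin m → ℝ≥0∞), ℝ)) (v : ℝ≥0) :
    tailIntegral G m f v = ∫ ξ, f (fun i => ((v * ∏ j ∈ Finset.Iic i, ξ j : ℝ≥0) : ℝ≥0∞))
      ∂Measure.pi fun _ : Fin m => G := by
  rw [tailIntegral, tailChainLaw, integral_map (by fun_prop)]
  refine (f.continuous.comp ?_).aestronglyMeasurable
  fun_prop

lemma finset_prod_Iic_succ_cons {m : ℕ} (a : ℝ≥0) (ξ : Fin m → ℝ≥0) (i : Fin m) :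
    ∏ j ∈ Finset.Iic i.succ, (Fin.cons a ξ : Fin (m + 1) → ℝ≥0) j =
      a * ∏ j ∈ Finset.Iic i, ξ j := by
  have h : Finset.Iic i.succ = insert 0 ((Finset.Iic i).map (Fin.succEmb m)) := by
    rw [Fin.map_succEmb_Iic]
    ext j
    simp only [Finset.mem_Iic, Finset.mem_insert, Finset.mem_Ioc]
    rcases Fin.eq_zero_or_eq_succ j with rfl | ⟨j, rfl⟩ <;> simp
  rw [h, Finset.prod_insert (by simp), Finset.prod_map]
  simp

lemma tailIntegral_succ (G : Measure ℝ≥0) [IsProbabilityMeasure G] {m : ℕ}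
    (f : C((Fin (m + 1) → ℝ≥0∞), ℝ)) (u : ℝ≥0) :
    tailIntegral G (m + 1) f u =
      ∫ ξ, tailIntegral G m (freezeHead f (u * ξ : ℝ≥0)) (u * ξ) ∂G := by
  let F : ℝ≥0 × (Fin m → ℝ≥0) → ℝ := fun p =>
    f (fun i => ((u * ∏ j ∈ Finset.Iic i, (Fin.cons p.1 p.2 : Fin (m + 1) → ℝ≥0) j : ℝ≥0) : ℝ≥0∞))
  have hcons : Continuous fun p : ℝ≥0 × (Fin m → ℝ≥0) =>
      (Fin.cons p.1 p.2 : Fin (m + 1) → ℝ≥0) := Continuous.finCons continuous_fst continuous_snd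
  have hF : Continuous F := by
    refine f.continuous.comp (continuous_pi fun i => ENNReal.continuous_coe.comp
      (continuous_const.mul (continuous_finsetProd _ fun j _ => ?_)))
    exact (continuous_apply j).comp hcons
  have hmp := measurePreserving_piFinSuccAbove (fun _ : Fin (m + 1) => G) 0
  have hFi : Integrable F (G.prod (Measure.pi fun _ : Fin m => G)) :=
    integrable_of_abs_le hF.measurable fun _ => f.norm_coe_le_norm _
  have h := hmp.integral_comp' F
  rw [tailIntegral_eq]
  have hleft : ∀ ξ : Fin (m + 1) → ℝ≥0,
      F (MeasurableEquiv.piFinSuccAbove (fun _ => ℝ≥0) 0 ξ) =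
        f (fun i => ((u * ∏ j ∈ Finset.Iic i, ξ j : ℝ≥0) : ℝ≥0∞)) := fun ξ => by
    have hξ : (Fin.cons (ξ 0) (fun j => ξ j.succ) : Fin (m + 1) → ℝ≥0) = ξ := Fin.cons_self_tail ξ
    simp only [F]
    change f (fun i => ((u * ∏ j ∈ Finset.Iic i,
      (Fin.cons (ξ 0) (fun j => ξ j.succ) : Fin (m + 1) → ℝ≥0) j : ℝ≥0) : ℝ≥0∞)) = _
    rw [hξ]
  simp only [hleft] at h
  rw [h, integral_prod F hFi]
  refine integral_congr_ae (ae_of_all _ fun a => ?_)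
  simp only [tailIntegral_eq, freezeHead_apply]
  refine integral_congr_ae (ae_of_all _ fun ξ => congrArg f ?_)
  ext i
  refine Fin.cases ?_ (fun i => ?_) i
  · have h0 : Finset.Iic (0 : Fin (m + 1)) = {0} := by ext; simp
    simp [h0]
  · simp only [finset_prod_Iic_succ_cons, Fin.cons_succ, mul_assoc]

lemma continuous_tailIntegral_freezeHead (G : Measure ℝ≥0) [IsProbabilityMeasure G] {m : ℕ}
    (f : C((Fin (m + 1) → ℝ≥0∞), ℝ)) :
    Continuous fun v : ℝ≥0 => tailIntegral G m (freezeHead f v) v := by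
  simp only [tailIntegral_eq, freezeHead_apply]
  refine continuous_of_dominated (bound := fun _ => ‖f‖) (fun v => ?_)
    (fun v => ae_of_all _ fun ξ => f.norm_coe_le_norm _) (integrable_const _)
    (ae_of_all _ fun ξ => ?_)
  · exact (f.continuous.comp (Continuous.finCons continuous_const
      (by fun_prop))).aestronglyMeasurable
  · exact f.continuous.comp (Continuous.finCons ENNReal.continuous_coe (by fun_prop))

lemma tailIntegral_zero_start (G : Measure ℝ≥0) [IsProbabilityMeasure G] {m : ℕ}
    (f : C((Fin m → ℝ≥0∞), ℝ)) : tailIntegral G m f 0 = f 0 := by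
  rw [tailIntegral_eq]
  have h0 : (fun _ => 0 : Fin m → ℝ≥0∞) = 0 := rfl
  simp [h0]

instance isProbabilityMeasure_tailChainLaw (G : Measure ℝ≥0) [IsProbabilityMeasure G] (m : ℕ)
    (v : ℝ≥0) : IsProbabilityMeasure (tailChainLaw G m v) :=
  Measure.isProbabilityMeasure_map (by fun_prop)

lemma abs_tailIntegral_le (G : Measure ℝ≥0) [IsProbabilityMeasure G] {m : ℕ}
    (f : C((Fin m → ℝ≥0∞), ℝ)) (v : ℝ≥0) : |tailIntegral G m f v| ≤ ‖f‖ := by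
  rw [tailIntegral, ← Real.norm_eq_abs]
  exact (norm_integral_le_of_norm_le_const (ae_of_all _ fun x => f.norm_coe_le_norm _)).trans
    (by simp)

lemma tendsto_mul_atTop_prod_nhds {u : ℝ≥0} (hu : 0 < u) :
    Tendsto (fun p : ℝ≥0 × ℝ≥0 => p.1 * p.2) (atTop ×ˢ 𝓝 u) atTop :=
  tendsto_fst.atTop_mul_pos hu tendsto_snd

/-- The domain of attraction property with initial states `t * v`, jointly in `t → ∞`, `v → u`. -/
lemma KernelDOA.tendsto_prod {K : Kernel ℝ≥0 ℝ≥0} [IsMarkovKernel K] {G : Measure ℝ≥0}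
    (hK : KernelDOA K G) {u : ℝ≥0} (hu : 0 < u) (g : C(ℝ≥0∞, ℝ)) :
    Tendsto (fun p : ℝ≥0 × ℝ≥0 => ∫ x, g (x : ℝ≥0∞) ∂(K (p.1 * p.2)).map (fun x => x / p.1))
      (atTop ×ˢ 𝓝 u) (𝓝 (∫ x, g (x : ℝ≥0∞) ∂G.map (fun x => u * x))) := by
  let μ : ℝ≥0 × ℝ≥0 → Measure ℝ≥0 := fun p =>
    (K (p.1 * p.2)).map (fun x => x / (p.1 * p.2))
  have : ∀ p, IsProbabilityMeasure (μ p) := fun p =>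
    Measure.isProbabilityMeasure_map (measurable_div_const _).aemeasurable
  have hμ : ∀ g : C(ℝ≥0∞, ℝ), Tendsto (fun p => ∫ x, g (x : ℝ≥0∞) ∂μ p) (atTop ×ˢ 𝓝 u)
      (𝓝 (∫ x, g (x : ℝ≥0∞) ∂G)) := fun g => by
    refine ((hK g).comp (tendsto_mul_atTop_prod_nhds hu)).congr fun p => ?_
    rw [integral_map (measurable_div_const _).aemeasurable
      (measurable_comp_coe_ennreal g).aestronglyMeasurable]
    rfl
  have hu0 : (u : ℝ≥0∞) ≠ 0 := by exact_mod_cast hu.ne'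
  let Ψ : C(ℝ≥0∞, ℝ) := ⟨fun a => g (u * a),
    g.continuous.comp (ENNReal.continuous_const_mul ENNReal.coe_ne_top)⟩
  have key := tendsto_integral_of_tendsto_locally hμ
    (Φ := fun p a => g (p.2 * a))
    (fun p => g.continuous.measurable.comp (measurable_const_mul _)) Ψ fun x => by
      refine (g.continuous.tendsto (u * x)).comp (ENNReal.Tendsto.mul ?_ (Or.inl hu0) tendsto_snd
        (Or.inr ENNReal.coe_ne_top))
      exact (ENNReal.continuous_coe.tendsto u).comp (tendsto_snd.comp tendsto_fst)
  have hlim : ∫ x, g (x : ℝ≥0∞) ∂G.map (fun x => u * x) = ∫ x, Ψ (x : ℝ≥0∞) ∂G := by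
    rw [integral_map (measurable_const_mul u).aemeasurable
      (measurable_comp_coe_ennreal g).aestronglyMeasurable]
    simp [Ψ]
  rw [hlim]
  refine key.congr' ?_
  filter_upwards [tendsto_fst.eventually (eventually_gt_atTop 0),
    tendsto_snd.eventually (lt_mem_nhds hu)] with p hp1 hp2
  have hgm : Measurable fun x : ℝ≥0 => g (p.2 * x) :=
    (g.continuous.measurable.comp (measurable_const_mul _)).comp measurable_coe_nnreal_ennreal
  rw [integral_map (measurable_div_const _).aemeasurable
      (measurable_comp_coe_ennreal g).aestronglyMeasurable,
    integral_map (measurable_div_const _).aemeasurable hgm.aestronglyMeasurable]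
  refine integral_congr_ae (ae_of_all _ fun x => ?_)
  simp only
  rw [← ENNReal.coe_mul]
  congr 2
  field_simp

lemma tendsto_ecIntegral (K : Kernel ℝ≥0 ℝ≥0) [IsMarkovKernel K] (G : Measure ℝ≥0)
    [IsProbabilityMeasure G] (hK : KernelDOA K G) (γ : ℝ≥0 → ℝ≥0)
    (hγ : UniformExtremalBoundary K G γ) (m : ℕ) {u : ℝ≥0} (hu : 0 < u)
    (f : C((Fin m → ℝ≥0∞), ℝ)) :
    Tendsto (fun p : ℝ≥0 × ℝ≥0 => ecIntegral K γ m f p.1 p.2) (atTop ×ˢ 𝓝 u)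
      (𝓝 (tailIntegral G m f u)) := by
  induction m generalizing u with
  | zero =>
    have h1 : ∀ p : ℝ≥0 × ℝ≥0, ecIntegral K γ 0 f p.1 p.2 = tailIntegral G 0 f u := fun p => by
      have hx : ∀ x : Fin 0 → ℝ≥0∞, f x = f 0 := fun x => congrArg f (Subsingleton.elim _ _)
      rw [ecIntegral, tailIntegral]
      simp_rw [hx]
      simp
    simp only [h1]
    exact tendsto_const_nhds
  | succ m ih =>
    let μ : ℝ≥0 × ℝ≥0 → Measure ℝ≥0 := fun p => (K (p.1 * p.2)).map (fun x => x / p.1)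
    have : ∀ p, IsProbabilityMeasure (μ p) := fun p =>
      Measure.isProbabilityMeasure_map (measurable_div_const _).aemeasurable
    have : IsProbabilityMeasure (G.map fun x => u * x) :=
      Measure.isProbabilityMeasure_map (measurable_const_mul u).aemeasurable
    have hγ0 : Tendsto (fun p : ℝ≥0 × ℝ≥0 => γ p.1) (atTop ×ˢ 𝓝 u) (𝓝 0) :=
      hγ.1.comp tendsto_fst
    have hmass : Tendsto (fun p => (μ p).real (Set.Iic (γ p.1))) (atTop ×ˢ 𝓝 u)
        (𝓝 ((G.map fun x => u * x).real {0})) := by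
      have h := (ENNReal.tendsto_toReal (measure_ne_top G {0})).comp
        (tendsto_atTop_prod_nhds_of_forall
          (F := fun t v => K (t * v) (Set.Iic (t * γ t))) fun ut => hγ.2 u ut hu)
      have h0 : (fun x => u * x) ⁻¹' {0} = ({0} : Set ℝ≥0) := by ext; simp [hu.ne']
      rw [map_measureReal_apply (measurable_const_mul u) (measurableSet_singleton _), h0]
      refine h.congr' ?_
      filter_upwards [tendsto_fst.eventually (eventually_gt_atTop 0)] with p hp
      have hpre : (fun x => x / p.1) ⁻¹' Set.Iic (γ p.1) = Set.Iic (p.1 * γ p.1) := by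
        ext x
        simp [div_le_iff₀ hp, mul_comm]
      rw [map_measureReal_apply (measurable_div_const _) measurableSet_Iic, hpre]
      rfl
    have hstart : tailIntegral G m (freezeHead f (0 : ℝ≥0)) 0 = f 0 := by
      rw [tailIntegral_zero_start, freezeHead_apply]
      refine congrArg f ?_
      ext i
      refine Fin.cases ?_ (fun i => ?_) i <;> simp
    have key := tendsto_integral_of_boundary (hK.tendsto_prod hu) hγ0 hmass
      (H := fun p w => if γ p.1 < w then ecIntegral K γ m (freezeHead f w) p.1 w else f 0)
      (fun p => Measurable.ite measurableSet_Ioi (measurable_ecIntegral_freezeHead K γ f p.1)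
        measurable_const) (M := ‖f‖) (fun p w => ?_)
      (continuous_tailIntegral_freezeHead G f)
      (fun v => (abs_tailIntegral_le G _ v).trans (norm_freezeHead_le f v))
      (fun p v hv => by rw [if_neg hv.not_gt, hstart]) (fun v hv => ?_)
    · rw [integral_map (measurable_const_mul u).aemeasurable
        (continuous_tailIntegral_freezeHead G f).aestronglyMeasurable, ← tailIntegral_succ] at key
      refine key.congr' ?_
      filter_upwards [tendsto_fst.eventually (eventually_gt_atTop 0),
        hγ0.eventually_lt tendsto_snd hu] with p hp hpγ
      exact (ecIntegral_succ K γ f hp hpγ).symm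
    · split_ifs
      · exact (abs_ecIntegral_le ..).trans (norm_freezeHead_le f w)
      · exact f.norm_coe_le_norm _
    · have hproj : Tendsto (fun q : (ℝ≥0 × ℝ≥0) × ℝ≥0 => (q.1.1, q.2))
          ((atTop ×ˢ 𝓝 u) ×ˢ 𝓝 v) (atTop ×ˢ 𝓝 v) :=
        (tendsto_fst.comp tendsto_fst).prodMk tendsto_snd
      have hmain := (ih hv (freezeHead f v)).comp hproj
      have hdist : Tendsto (fun q : (ℝ≥0 × ℝ≥0) × ℝ≥0 => dist (freezeHead f q.2) (freezeHead f v))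
          ((atTop ×ˢ 𝓝 u) ×ˢ 𝓝 v) (𝓝 0) :=
        tendsto_iff_dist_tendsto_zero.1
          ((((freezeHead f).continuous.comp ENNReal.continuous_coe).tendsto v).comp tendsto_snd)
      have hdiff := squeeze_zero_norm (a := fun q : (ℝ≥0 × ℝ≥0) × ℝ≥0 =>
        dist (freezeHead f q.2) (freezeHead f v)) (fun q => by
          rw [Real.norm_eq_abs]
          exact abs_ecIntegral_sub_le K γ m (freezeHead f q.2) (freezeHead f v) q.1.1 q.2) hdist
      have hsum := hdiff.add hmain
      rw [zero_add] at hsum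
      refine hsum.congr' ?_
      filter_upwards [(hγ0.comp tendsto_fst).eventually_lt tendsto_snd hv] with q hq
      simp only [Function.comp_apply] at hq
      rw [if_pos hq]
      simp

/-- Conditional on `X_0 = t u_t` with `u_t → u > 0`, the laws of the scaled extremal
component `(X^{(t)}_1/t, …, X^{(t)}_m/t)` converge weakly on `[0,∞]^m` to the law of the
tail chain `(T*_1, …, T*_m)` started from `u`. -/
theorem extremal_component_fdd_convergence (K : Kernel ℝ≥0 ℝ≥0) [IsMarkovKernel K]
    (G : Measure ℝ≥0) [IsProbabilityMeasure G] (hK : KernelDOA K G)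
    (γ : ℝ≥0 → ℝ≥0) (hγ : UniformExtremalBoundary K G γ)
    (m : ℕ) (hm : 1 ≤ m)
    (u : ℝ≥0) (hu : 0 < u) (ut : ℝ≥0 → ℝ≥0) (hut : Tendsto ut atTop (𝓝 u))
    (f : C((Fin m → ℝ≥0∞), ℝ)) :
    Tendsto (fun t : ℝ≥0 =>
        ∫ x, f (fun i => ((ecMap m (t * γ t) (t * ut t) x i / t : ℝ≥0) : ℝ≥0∞))
          ∂(jointLaw K m (t * ut t)))
      atTop
      (𝓝 (∫ x, f (fun i => (x i : ℝ≥0∞)) ∂(tailChainLaw G m u))) := by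
  exact (tendsto_ecIntegral K G hK γ hγ m hu f).comp (tendsto_id.prodMk hut)
end
end

section
/- Suppose K ∈ D(G). Then Perfekt's condition lim_{δ↓0} limsup_{t→∞} sup_{u∈[0,δ]} K(tu, (t,∞]) = 0 holds if and only if K satisfies the regularity condition, i.e., K(tu_t, t·) converges weakly to δ_0 on [0,∞] as t → ∞ for every nonnegative function u_t = u(t) with u_t → 0. -/
open MeasureTheory ProbabilityTheory Filter Topology
open scoped NNReal ENNReal

noncomputable section

/-- The regularity condition: `K(t u_t, t·)` converges weakly on `[0,∞]` to the point
mass `δ_0` as `t → ∞`, for every nonnegative function `u_t → 0`. -/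
def RegCond (K : Kernel ℝ≥0 ℝ≥0) : Prop :=
  ∀ u : ℝ≥0 → ℝ≥0, Tendsto u atTop (𝓝 0) →
    ∀ f : C(ℝ≥0∞, ℝ),
      Tendsto (fun t : ℝ≥0 => ∫ x, f ((x / t : ℝ≥0) : ℝ≥0∞) ∂(K (t * u t)))
        atTop (𝓝 (f 0))

/-- If a property holds eventually along the graph of every function tending to `0` at infinity,
then it holds eventually for the product filter `atTop ×ˢ 𝓝 0`. -/
lemma eventually_prod_of_forall_tendsto {P : ℝ≥0 × ℝ≥0 → Prop}
    (h : ∀ u : ℝ≥0 → ℝ≥0, Tendsto u atTop (𝓝 0) → ∀ᶠ t in atTop, P (t, u t)) :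
    ∀ᶠ p in (atTop : Filter ℝ≥0) ×ˢ 𝓝 (0 : ℝ≥0), P p := by
  classical
  by_contra hP
  obtain ⟨x, hx, hxP⟩ := exists_seq_forall_of_frequently (not_eventually.1 hP)
  have hx1 : Tendsto (fun n => (x n).1) atTop atTop := tendsto_fst.comp hx
  have hx2 : Tendsto (fun n => (x n).2) atTop (𝓝 0) := tendsto_snd.comp hx
  let u : ℝ≥0 → ℝ≥0 := fun t => if ht : ∃ n, (x n).1 = t then (x ht.choose).2 else 0
  have hu : Tendsto u atTop (𝓝 0) := by
    intro s hs
    obtain ⟨N, hN⟩ := eventually_atTop.1 (hx2.eventually hs)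
    have hlarge : ∀ᶠ t in atTop, ∀ n ∈ Finset.range N, (x n).1 < t :=
      (Filter.eventually_all_finset _).2 fun n _ => eventually_gt_atTop _
    change ∀ᶠ t in atTop, u t ∈ s
    filter_upwards [hlarge] with t ht
    by_cases h' : ∃ n, (x n).1 = t
    · have hut : u t = (x h'.choose).2 := dif_pos h'
      have hle : N ≤ h'.choose := by
        by_contra! hlt
        exact (ht _ (Finset.mem_range.2 hlt)).ne h'.choose_spec
      exact hut ▸ hN _ hle
    · simpa [u, h'] using mem_of_mem_nhds hs
  obtain ⟨n, hn⟩ := (hx1.eventually (h u hu)).exists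
  have h' : ∃ m, (x m).1 = (x n).1 := ⟨n, rfl⟩
  refine hxP h'.choose ?_
  have hpair : x h'.choose = ((x n).1, u (x n).1) :=
    Prod.ext h'.choose_spec (by simp [u, h'])
  exact hpair ▸ hn

lemma integrable_continuousMap_div (μ : Measure ℝ≥0) [IsFiniteMeasure μ] (f : C(ℝ≥0∞, ℝ))
    (t : ℝ≥0) : Integrable (fun x : ℝ≥0 => f ((x / t : ℝ≥0) : ℝ≥0∞)) μ := by
  have hcont : Continuous fun x : ℝ≥0 => f ((x / t : ℝ≥0) : ℝ≥0∞) :=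
    f.continuous.comp (ENNReal.continuous_coe.comp (continuous_id.div_const t))
  exact Integrable.of_bound hcont.aestronglyMeasurable ‖f‖
    (ae_of_all _ fun x => f.norm_coe_le_norm _)

/-- The continuous function `y ↦ min y 1` on `[0,∞]`, with real values. -/
def truncOne : C(ℝ≥0∞, ℝ) where
  toFun y := (min y 1).toReal
  continuous_toFun := ENNReal.continuousOn_toReal.comp_continuous
    (continuous_id.min continuous_const) fun _ => ne_top_of_le_ne_top ENNReal.one_ne_top
      (min_le_right _ _)

lemma measureReal_Ioi_le_integral_truncOne (μ : Measure ℝ≥0) [IsFiniteMeasure μ] {t : ℝ≥0}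
    (ht : 0 < t) : μ.real (Set.Ioi t) ≤ ∫ x, truncOne ((x / t : ℝ≥0) : ℝ≥0∞) ∂μ := by
  rw [← integral_indicator_one measurableSet_Ioi]
  refine integral_mono ((integrable_const 1).indicator measurableSet_Ioi)
    (integrable_continuousMap_div μ truncOne t) fun x => ?_
  by_cases hx : x ∈ Set.Ioi t
  · have h1 : (1 : ℝ≥0∞) ≤ ((x / t : ℝ≥0) : ℝ≥0∞) := by
      exact_mod_cast (one_le_div ht).2 (le_of_lt hx)
    simp only [Set.indicator_of_mem hx, truncOne, ContinuousMap.coe_mk, min_eq_right h1]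
    simp
  · rw [Set.indicator_of_notMem hx]
    exact ENNReal.toReal_nonneg

lemma RegCond.tendsto_measure_Ioi {K : Kernel ℝ≥0 ℝ≥0} [IsMarkovKernel K] (hK : RegCond K)
    {u : ℝ≥0 → ℝ≥0} (hu : Tendsto u atTop (𝓝 0)) :
    Tendsto (fun t => K (t * u t) (Set.Ioi t)) atTop (𝓝 0) := by
  have h := hK u hu truncOne
  have h0 : truncOne 0 = 0 := by simp [truncOne]
  rw [h0] at h
  refine (ENNReal.tendsto_toReal_iff (fun t => measure_ne_top _ _) ENNReal.zero_ne_top).1 ?_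
  refine squeeze_zero' (Eventually.of_forall fun t => ENNReal.toReal_nonneg) ?_ h
  filter_upwards [eventually_gt_atTop 0] with t ht
  exact measureReal_Ioi_le_integral_truncOne _ ht

/-- If the mass of `μ t` outside `[0, ε t]` vanishes as `t → ∞` for each `ε > 0`, then the
rescaled measures converge weakly on `[0,∞]` to `δ_0`. -/
lemma tendsto_integral_div_of_tendsto_measure_Ioi (μ : ℝ≥0 → Measure ℝ≥0)
    [∀ t, IsProbabilityMeasure (μ t)]
    (h : ∀ ε : ℝ≥0, 0 < ε → Tendsto (fun t => μ t (Set.Ioi (ε * t))) atTop (𝓝 0))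
    (f : C(ℝ≥0∞, ℝ)) :
    Tendsto (fun t : ℝ≥0 => ∫ x, f ((x / t : ℝ≥0) : ℝ≥0∞) ∂(μ t)) atTop (𝓝 (f 0)) := by
  rw [Metric.tendsto_nhds]
  intro η hη
  have hf : ∀ᶠ y : ℝ≥0 in 𝓝 0, dist (f (y : ℝ≥0∞)) (f 0) < η / 2 :=
    (Metric.tendsto_nhds.1 (((f.continuous.comp ENNReal.continuous_coe).tendsto 0)) _ (half_pos hη))
  obtain ⟨ε, hε, hball⟩ := (nhds_bot_basis_Iic (α := ℝ≥0)).eventually_iff.1 hf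
  replace hε : 0 < ε := hε
  have hmass : Tendsto (fun t => 2 * ‖f‖ * (μ t).real (Set.Ioi (ε * t))) atTop (𝓝 0) := by
    simpa [measureReal_def] using
      ((ENNReal.tendsto_toReal ENNReal.zero_ne_top).comp (h ε hε)).const_mul (2 * ‖f‖)
  filter_upwards [hmass.eventually (gt_mem_nhds (half_pos hη)), eventually_gt_atTop 0] with t ht ht0
  have hint := integrable_continuousMap_div (μ t) f t
  have hbound : ∀ x : ℝ≥0, ‖f ((x / t : ℝ≥0) : ℝ≥0∞) - f 0‖ ≤
      η / 2 + (Set.Ioi (ε * t)).indicator (fun _ => 2 * ‖f‖) x := by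
    intro x
    by_cases hx : x ∈ Set.Ioi (ε * t)
    · rw [Set.indicator_of_mem hx]
      have h1 := norm_sub_le (f ((x / t : ℝ≥0) : ℝ≥0∞)) (f 0)
      have h2 := f.norm_coe_le_norm ((x / t : ℝ≥0) : ℝ≥0∞)
      have h3 := f.norm_coe_le_norm 0
      linarith
    · rw [Set.indicator_of_notMem hx, add_zero, ← dist_eq_norm]
      exact (hball ((div_le_iff₀ ht0).2 (not_lt.1 hx))).le
  have hind : Integrable ((Set.Ioi (ε * t)).indicator fun _ => 2 * ‖f‖) (μ t) :=
    (integrable_const _).indicator measurableSet_Ioi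
  calc dist (∫ x, f ((x / t : ℝ≥0) : ℝ≥0∞) ∂(μ t)) (f 0)
      = ‖∫ x, (f ((x / t : ℝ≥0) : ℝ≥0∞) - f 0) ∂(μ t)‖ := by
        rw [integral_sub hint (integrable_const _)]
        simp [dist_eq_norm]
    _ ≤ ∫ x, (η / 2 + (Set.Ioi (ε * t)).indicator (fun _ => 2 * ‖f‖) x) ∂(μ t) :=
        norm_integral_le_of_norm_le ((integrable_const _).add hind) (ae_of_all _ hbound)
    _ = η / 2 + 2 * ‖f‖ * (μ t).real (Set.Ioi (ε * t)) := by
        rw [integral_add (integrable_const _) hind, integral_indicator_const _ measurableSet_Ioi]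
        simp [mul_comm]
    _ < η := by linarith

/-- Perfekt's condition bounds the tails of `K (t * u t)` beyond any positive multiple of `t`. -/
lemma tendsto_measure_Ioi_of_perfekt {K : Kernel ℝ≥0 ℝ≥0}
    (hP : Tendsto (fun δ : ℝ≥0 => Filter.limsup (fun t : ℝ≥0 =>
      ⨆ u ∈ Set.Icc (0 : ℝ≥0) δ, (K (t * u)) (Set.Ioi t)) atTop) (𝓝[>] 0) (𝓝 0))
    {u : ℝ≥0 → ℝ≥0} (hu : Tendsto u atTop (𝓝 0)) {ε : ℝ≥0} (hε : 0 < ε) :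
    Tendsto (fun t => K (t * u t) (Set.Ioi (ε * t))) atTop (𝓝 0) := by
  rw [ENNReal.tendsto_nhds_zero]
  intro η hη
  obtain ⟨δ, hδη, hδ⟩ :=
    ((hP.eventually (gt_mem_nhds hη)).and self_mem_nhdsWithin).exists
  replace hδ : 0 < δ := hδ
  have hscale : Tendsto (fun t => ε * t) atTop atTop := tendsto_id.const_mul_atTop hε
  have hsmall : ∀ᶠ t in atTop, u t ≤ ε * δ :=
    hu.eventually (ge_mem_nhds (mul_pos hε hδ))
  filter_upwards [hscale.eventually (eventually_lt_of_limsup_lt hδη), hsmall] with t ht htu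
  have hmem : u t / ε ∈ Set.Icc 0 δ := ⟨zero_le, (div_le_iff₀' hε).2 htu⟩
  have heq : ε * t * (u t / ε) = t * u t := by field_simp
  have hle := le_iSup₂ (f := fun v (_ : v ∈ Set.Icc 0 δ) => K (ε * t * v) (Set.Ioi (ε * t)))
    _ hmem
  rw [heq] at hle
  exact hle.trans ht.le

/-- For `K ∈ D(G)`, Perfekt's condition
`lim_{δ↓0} limsup_{t→∞} sup_{u∈[0,δ]} K(tu,(t,∞]) = 0` holds iff `K` satisfies the
regularity condition. -/
theorem perfekt_iff_regularity (K : Kernel ℝ≥0 ℝ≥0) [IsMarkovKernel K]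
    (G : Measure ℝ≥0) [IsProbabilityMeasure G] (hK : KernelDOA K G) :
    Tendsto (fun δ : ℝ≥0 =>
        Filter.limsup (fun t : ℝ≥0 =>
          ⨆ u ∈ Set.Icc (0 : ℝ≥0) δ, (K (t * u)) (Set.Ioi t)) atTop)
      (𝓝[>] 0) (𝓝 0)
    ↔ RegCond K := by
  constructor
  · intro hP u hu f
    exact tendsto_integral_div_of_tendsto_measure_Ioi (fun t => K (t * u t))
      (fun _ hε => tendsto_measure_Ioi_of_perfekt hP hu hε) f
  · intro hR
    rw [ENNReal.tendsto_nhds_zero]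
    intro η hη
    have hev : ∀ᶠ p in (atTop : Filter ℝ≥0) ×ˢ 𝓝 (0 : ℝ≥0), K (p.1 * p.2) (Set.Ioi p.1) ≤ η :=
      eventually_prod_of_forall_tendsto fun u hu =>
        ENNReal.tendsto_nhds_zero.1 (hR.tendsto_measure_Ioi hu) η hη
    obtain ⟨pt, hpt, pu, hpu, hpair⟩ := eventually_prod_iff.1 hev
    obtain ⟨r, hr, hball⟩ := (nhds_bot_basis_Iic (α := ℝ≥0)).eventually_iff.1 hpu
    filter_upwards [nhdsWithin_le_nhds (ge_mem_nhds hr)] with δ hδ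
    refine limsup_le_of_le (by isBoundedDefault) ?_
    filter_upwards [hpt] with t ht
    exact iSup₂_le fun v hv => hpair ht (hball (hv.2.trans hδ))
end
end

section
/- Suppose K ∈ D(G), and let ψ(·,V) be an update function corresponding to K such that ψ(t,v)/t → ξ(v) as t → ∞ for every v in a set B with P[V ∈ B] = 1, where ξ∘V has distribution G. If Segers' condition holds — limsup_{t→∞} sup_{0≤y≤t} ψ(y,v)/t < ∞ for every v in a set B_0 with P[V ∈ B_0] = 1 — then K satisfies the regularity condition. -/
open MeasureTheory ProbabilityTheory Filter Topology
open scoped NNReal ENNReal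

noncomputable section

/-- A linear bound on the running suprema of `g` forces `g (t u_t) / t → 0` when `u_t → 0`. -/
theorem tendsto_div_of_limsup_iSup_lt_top (g : ℝ≥0 → ℝ≥0)
    (hg : Filter.limsup (fun t : ℝ≥0 =>
      ⨆ y ∈ Set.Icc (0 : ℝ≥0) t, ((g y : ℝ≥0∞) / (t : ℝ≥0∞))) atTop < ⊤)
    (u : ℝ≥0 → ℝ≥0) (hu : Tendsto u atTop (𝓝 0)) :
    Tendsto (fun t : ℝ≥0 => g (t * u t) / t) atTop (𝓝 0) := by
  obtain ⟨M, hM, hMtop⟩ := exists_between hg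
  lift M to ℝ≥0 using hMtop.ne
  obtain ⟨T, hT⟩ := eventually_atTop.1 ((eventually_lt_of_limsup_lt hM).and (eventually_gt_atTop 0))
  have key : ∀ s, T ≤ s → ∀ y ≤ s, g y ≤ M * s := by
    intro s hs y hy
    obtain ⟨hlt, hpos⟩ := hT s hs
    have hle : (g y : ℝ≥0∞) / (s : ℝ≥0∞) ≤ M :=
      (le_iSup₂ (f := fun (y : ℝ≥0) (_ : y ∈ Set.Icc (0 : ℝ≥0) s) =>
        (g y : ℝ≥0∞) / (s : ℝ≥0∞)) y ⟨zero_le, hy⟩).trans hlt.le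
    rw [← ENNReal.coe_div hpos.ne', ENNReal.coe_le_coe] at hle
    exact (div_le_iff₀ hpos).1 hle
  have hbound : Tendsto (fun t : ℝ≥0 => M * max (T / t) (u t)) atTop (𝓝 0) := by
    have hT0 : Tendsto (fun t : ℝ≥0 => T / t) atTop (𝓝 0) := by
      simpa [div_eq_mul_inv] using (tendsto_inv_atTop_zero (𝕜 := ℝ≥0)).const_mul T
    simpa using (hT0.max hu).const_mul M
  refine tendsto_of_tendsto_of_tendsto_of_le_of_le' tendsto_const_nhds hbound
    (Eventually.of_forall fun _ => zero_le) ?_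
  filter_upwards [eventually_gt_atTop 0] with t ht
  rw [div_le_iff₀ ht, mul_assoc, max_mul_of_nonneg _ _ ht.le, div_mul_cancel₀ _ ht.ne',
    mul_comm (u t)]
  exact key _ (le_max_left _ _) _ (le_max_right _ _)

/-- If `K ∈ D(G)` has an update function `ψ(·,V)` with `ψ(t,v)/t → ξ(v)` a.s. and
`ξ∘V ~ G`, and Segers' condition holds — `limsup_{t→∞} sup_{0≤y≤t} ψ(y,v)/t < ∞`
for a.e. `v` — then `K` satisfies the regularity condition. -/
theorem segers_implies_regularity {Ω E : Type*} [MeasurableSpace Ω] [MeasurableSpace E]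
    (P : Measure Ω) [IsProbabilityMeasure P]
    (K : Kernel ℝ≥0 ℝ≥0) [IsMarkovKernel K]
    (G : Measure ℝ≥0) [IsProbabilityMeasure G] (hK : KernelDOA K G)
    (V : Ω → E) (hV : Measurable V)
    (ψ : ℝ≥0 → E → ℝ≥0) (hψ : Measurable (Function.uncurry ψ))
    (hupd : ∀ y : ℝ≥0, Measure.map (fun ω => ψ y (V ω)) P = K y)
    (ξ : E → ℝ≥0)
    (B : Set E) (hB : MeasurableSet B) (hPB : P (V ⁻¹' B) = 1)
    (hlim : ∀ v ∈ B, Tendsto (fun t : ℝ≥0 => ψ t v / t) atTop (𝓝 (ξ v)))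
    (hdist : Measure.map (fun ω => ξ (V ω)) P = G)
    (B0 : Set E) (hB0 : MeasurableSet B0) (hPB0 : P (V ⁻¹' B0) = 1)
    (hsegers : ∀ v ∈ B0,
      Filter.limsup (fun t : ℝ≥0 =>
        ⨆ y ∈ Set.Icc (0 : ℝ≥0) t, ((ψ y v : ℝ≥0∞) / (t : ℝ≥0∞))) atTop < ⊤) :
    RegCond K := by
  intro u hu f
  have hψV (y : ℝ≥0) : Measurable fun ω => ψ y (V ω) :=
    hψ.comp (measurable_const.prodMk hV)
  have hf (t : ℝ≥0) : Measurable fun x : ℝ≥0 => f ((x / t : ℝ≥0) : ℝ≥0∞) :=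
    f.continuous.measurable.comp (measurable_id.div_const t).coe_nnreal_ennreal
  have hmap (t : ℝ≥0) : ∫ x, f ((x / t : ℝ≥0) : ℝ≥0∞) ∂(K (t * u t)) =
      ∫ ω, f ((ψ (t * u t) (V ω) / t : ℝ≥0) : ℝ≥0∞) ∂P := by
    rw [← hupd, integral_map (hψV _).aemeasurable (hf t).aestronglyMeasurable]
  simp_rw [hmap]
  have hB0ae : ∀ᵐ ω ∂P, V ω ∈ B0 := (mem_ae_iff_prob_eq_one (hV hB0)).2 hPB0
  have hconst : f 0 = ∫ _, f 0 ∂P := by simp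
  rw [hconst]
  refine tendsto_integral_filter_of_dominated_convergence (fun _ => ‖f‖)
    (Eventually.of_forall fun t => ((hf t).comp (hψV _)).aestronglyMeasurable)
    (Eventually.of_forall fun t => ae_of_all _ fun ω => f.norm_coe_le_norm _)
    (integrable_const _) ?_
  filter_upwards [hB0ae] with ω hω
  have h := tendsto_div_of_limsup_iSup_lt_top (fun y => ψ y (V ω)) (hsegers _ hω) u hu
  have h' := ENNReal.tendsto_coe.2 h
  rw [ENNReal.coe_zero] at h'
  exact (f.continuous.tendsto 0).comp h'
end
end
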